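/- Let p ≥ 5 be a prime and let φ: ℙ¹ → ℙ¹ be an endomorphism of degree d ≥ 2 defined over F_p(t) with good reduction at every finite place. If P ∈ ℙ¹(F_p(t)) is a preperiodic point for φ, then |O_φ(P)| ≤ (p+1)(p²−1)p. -/

import Mathlib

set_option synthInstance.maxHeartbeats 1000000
noncomputable section

/-- The `v`-adic logarithmic distance between coordinate representatives of points of
`ℙ¹(K)`. -/
def logDist {K : Type} [Field K] (v : K → WithTop ℤ) (P Q : K × K) : WithTop ℤ :=
  v (P.1 * Q.2 - Q.1 * P.2) - min (v P.1) (v P.2) - min (v Q.1) (v Q.2)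

/-- Evaluation at a point of the pair of binary forms
`F(X,Y) = ∑ aᵢ Xⁱ Y^(d−i)`, `G(X,Y) = ∑ bᵢ Xⁱ Y^(d−i)` of degree `d`,
i.e. the map `φ([X:Y]) = [F(X,Y):G(X,Y)]` in homogeneous coordinates. -/
def evalPair {K : Type} [CommRing K] (d : ℕ) (a b : Fin (d+1) → K) (P : K × K) : K × K :=
  (∑ i : Fin (d+1), a i * P.1 ^ (i:ℕ) * P.2 ^ (d - (i:ℕ)),
   ∑ i : Fin (d+1), b i * P.1 ^ (i:ℕ) * P.2 ^ (d - (i:ℕ)))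

/-- The Sylvester matrix of the two binary forms of degree `d` with coefficient
vectors `a`, `b`. -/
def sylvester {K : Type} [CommRing K] (d : ℕ) (a b : Fin (d+1) → K) :
    Matrix (Fin (d+d)) (Fin (d+d)) K :=
  fun i j =>
    if _ : (i:ℕ) < d then
      if hj : (i:ℕ) ≤ (j:ℕ) ∧ (j:ℕ) ≤ (i:ℕ) + d then a ⟨(j:ℕ) - (i:ℕ), by omega⟩ else 0
    else
      if hj : (i:ℕ) - d ≤ (j:ℕ) ∧ (j:ℕ) ≤ (i:ℕ) then b ⟨(j:ℕ) - ((i:ℕ) - d), by omega⟩ else 0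

/-- The (homogeneous) resultant `Res(F,G)` of the two binary forms of degree `d`,
as the determinant of their Sylvester matrix. -/
def resultant {K : Type} [CommRing K] (d : ℕ) (a b : Fin (d+1) → K) : K :=
  (sylvester d a b).det

/-- The map `φ = [F:G]` has good reduction at the place `v`: after multiplying `F`
and `G` by a suitable nonzero scalar `u` (so as to be in `v`-reduced form: all
coefficients in the valuation ring of `v` and at least one of them a `v`-unit), the
resultant `Res(uF, uG)` is a `v`-unit. -/
def GoodReduction {K : Type} [Field K] (v : K → WithTop ℤ) (d : ℕ)
    (a b : Fin (d+1) → K) : Prop :=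
  ∃ u : K, u ≠ 0 ∧ (∀ i, 0 ≤ v (u * a i) ∧ 0 ≤ v (u * b i)) ∧
    ((∃ i, v (u * a i) = 0) ∨ (∃ i, v (u * b i) = 0)) ∧
    v (resultant d (fun i => u * a i) (fun i => u * b i)) = 0

open scoped Classical

/-- The valuation of `F_p(t)` attached to a monic irreducible polynomial `π` (a
finite place of `F_p(t)`). -/
def polyVal (p : ℕ) [Fact p.Prime] (π : Polynomial (ZMod p)) (f : RatFunc (ZMod p)) :
    WithTop ℤ :=
  if f = 0 then ⊤ else
    ((((UniqueFactorizationMonoid.normalizedFactors f.num).count π : ℤ) -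
      ((UniqueFactorizationMonoid.normalizedFactors f.denom).count π : ℤ) : ℤ) : WithTop ℤ)

/-- The determinant of a pair of vectors; it vanishes iff the vectors are proportional. -/
def cross {R : Type*} [CommRing R] (P Q : R × R) : R := P.1 * Q.2 - Q.1 * P.2

lemma cross_comm_neg {R : Type*} [CommRing R] (P Q : R × R) : cross P Q = -cross Q P := by
  simp only [cross]; ring

lemma cross_same {R : Type*} [CommRing R] (P : R × R) : cross P P = 0 := by
  simp only [cross]; ring

lemma dvd_cross_comm {R : Type*} [CommRing R] {e : R} {P Q : R × R} :
    e ∣ cross P Q ↔ e ∣ cross Q P := by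
  rw [cross_comm_neg, dvd_neg]

lemma dvd_cross_trans {R : Type*} [CommRing R] {e : R} {A B C : R × R}
    (hB : IsCoprime B.1 B.2) (h₁ : e ∣ cross A B) (h₂ : e ∣ cross B C) : e ∣ cross A C := by
  obtain ⟨s, t, hst⟩ := hB
  obtain ⟨f, hf⟩ := h₁
  obtain ⟨g, hg⟩ := h₂
  refine ⟨(s * A.1 + t * A.2) * g + (s * C.1 + t * C.2) * f, ?_⟩
  simp only [cross] at *
  linear_combination (-(A.1 * C.2 - C.1 * A.2)) * hst + (s * A.1 + t * A.2) * hg +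
    (s * C.1 + t * C.2) * hf

lemma cross_plucker {R : Type*} [CommRing R] (A B C D : R × R) :
    cross A B * cross C D - cross A C * cross B D + cross A D * cross B C = 0 := by
  simp only [cross]; ring

/-- A sequence of coprime pairs along which, at every place, the distance between two points
does not increase under a simultaneous shift. -/
structure IsContracting {R : Type*} [CommRing R] (Q : ℕ → R × R) : Prop where
  coprime : ∀ i, IsCoprime (Q i).1 (Q i).2
  dvd_succ : ∀ i j, cross (Q i) (Q j) ∣ cross (Q (i + 1)) (Q (j + 1))

namespace IsContracting

variable {R : Type*} [CommRing R] {Q : ℕ → R × R}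

lemma dvd_add (h : IsContracting Q) (i j s : ℕ) :
    cross (Q i) (Q j) ∣ cross (Q (i + s)) (Q (j + s)) := by
  induction s with
  | zero => exact dvd_rfl
  | succ s ih => exact ih.trans (h.dvd_succ _ _)

lemma subsequence (h : IsContracting Q) (c n : ℕ) : IsContracting fun k => Q (c + n * k) where
  coprime _ := h.coprime _
  dvd_succ i j := by
    have := h.dvd_add (c + n * i) (c + n * j) n
    simpa only [mul_add, mul_one, add_assoc] using this

lemma dvd_cross_mul (h : IsContracting Q) {e : R} {i k : ℕ} (he : e ∣ cross (Q i) (Q (i + k)))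
    (s : ℕ) : e ∣ cross (Q i) (Q (i + k * s)) := by
  induction s with
  | zero => simp [cross_same]
  | succ s ih =>
    refine dvd_cross_trans (h.coprime _) ih ?_
    have := he.trans (h.dvd_add _ _ (k * s))
    rwa [show i + k + k * s = i + k * (s + 1) by ring] at this

lemma cross_mul_eq_zero (h : IsContracting Q) {i k : ℕ} (he : cross (Q i) (Q (i + k)) = 0)
    (s : ℕ) : cross (Q i) (Q (i + k * s)) = 0 :=
  zero_dvd_iff.mp (h.dvd_cross_mul (zero_dvd_iff.mpr he) s)

lemma cross_add_eq_zero (h : IsContracting Q) {i j : ℕ} (he : cross (Q i) (Q j) = 0)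
    (s : ℕ) : cross (Q (i + s)) (Q (j + s)) = 0 :=
  zero_dvd_iff.mp (he ▸ h.dvd_add i j s)

lemma cross_trans (h : IsContracting Q) {i j k : ℕ} (h₁ : cross (Q i) (Q j) = 0)
    (h₂ : cross (Q j) (Q k) = 0) : cross (Q i) (Q k) = 0 :=
  zero_dvd_iff.mp (dvd_cross_trans (h.coprime _) (zero_dvd_iff.mpr h₁) (zero_dvd_iff.mpr h₂))

/-- In a periodic sequence distances are invariant under shifts. -/
lemma dvd_cross_of_periodic (h : IsContracting Q) {n : ℕ} (hn : 0 < n)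
    (h0 : cross (Q 0) (Q n) = 0) (i k j : ℕ) :
    cross (Q i) (Q (i + k)) ∣ cross (Q j) (Q (j + k)) := by
  have hper : ∀ a s, cross (Q a) (Q (a + n * s)) = 0 := fun a s => by
    refine h.cross_mul_eq_zero ?_ s
    have := h.cross_add_eq_zero h0 a
    rwa [zero_add, add_comm n] at this
  have h1 := h.dvd_add i (i + k) (n * i - i + j)
  have hle : i ≤ n * i := Nat.le_mul_of_pos_left i hn
  rw [show i + (n * i - i + j) = j + n * i by omega,
    show i + k + (n * i - i + j) = j + k + n * i by omega] at h1
  refine dvd_cross_trans (h.coprime (j + n * i)) ?_ (dvd_cross_trans (h.coprime _) h1 ?_)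
  · rw [hper]; exact dvd_zero _
  · rw [dvd_cross_comm, hper]; exact dvd_zero _

lemma dvd_cross_of_coprime (h : IsContracting Q) {n : ℕ} (hn : 0 < n)
    (h0 : cross (Q 0) (Q n) = 0) {i k : ℕ} (hk : k.Coprime n) (a b : ℕ) :
    cross (Q i) (Q (i + k)) ∣ cross (Q a) (Q b) := by
  set e := cross (Q i) (Q (i + k)) with he
  have hstep : e ∣ cross (Q 0) (Q 1) := by
    have hk0 : e ∣ cross (Q 0) (Q (0 + k)) := h.dvd_cross_of_periodic hn h0 i k 0
    rcases (Nat.succ_le_of_lt hn).eq_or_lt with rfl | hn1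
    · rw [h0]; exact dvd_zero _
    obtain ⟨s, t, hst⟩ : ∃ s t, 0 + k * s = 1 + n * t := by
      obtain ⟨s, -, hs⟩ := Nat.exists_mul_mod_eq_one_of_coprime hk hn1
      exact ⟨s, k * s / n, by rw [zero_add, ← hs, Nat.mod_add_div]⟩
    have h1 := h.dvd_cross_mul hk0 s
    rw [hst] at h1
    refine dvd_cross_trans (h.coprime _) h1 ?_
    rw [dvd_cross_comm, h.cross_mul_eq_zero]
    · exact dvd_zero _
    · have := h.cross_add_eq_zero h0 1
      rwa [zero_add, add_comm n] at this
  have hall : ∀ a, e ∣ cross (Q 0) (Q a) := fun a => by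
    simpa using h.dvd_cross_mul (i := 0) (k := 1) (by simpa using hstep) a
  exact dvd_cross_trans (h.coprime _) (dvd_cross_comm.mp (hall a)) (hall b)

lemma associated_of_coprime [IsDomain R] (h : IsContracting Q) {n : ℕ} (hn : 0 < n)
    (h0 : cross (Q 0) (Q n) = 0) {k : ℕ} (hk : k.Coprime n) (i : ℕ) :
    Associated (cross (Q 0) (Q 1)) (cross (Q i) (Q (i + k))) :=
  associated_of_dvd_dvd (h.dvd_cross_of_coprime (i := 0) hn h0 (Nat.coprime_one_left n) _ _)
    (h.dvd_cross_of_coprime hn h0 hk _ _)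

end IsContracting

open Polynomial in
lemma mem_span_pair_of_cross {F : Type*} [Field F] {A B D : F[X] × F[X]} (hAB : cross A B ≠ 0)
    {α β : F} (hα : cross D B = C α * cross A B) (hβ : cross A D = C β * cross A B) :
    D ∈ Submodule.span F {A, B} := by
  refine Submodule.mem_span_pair.mpr ⟨α, β, ?_⟩
  ext1 <;> refine mul_left_cancel₀ hAB ?_ <;>
    simp only [Prod.fst_add, Prod.snd_add, Prod.smul_fst, Prod.smul_snd, smul_eq_C_mul]
  · have : cross A B * D.1 = cross D B * A.1 + cross A D * B.1 := by simp only [cross]; ring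
    rw [this, hα, hβ]; ring
  · have : cross A B * D.2 = cross D B * A.2 + cross A D * B.2 := by simp only [cross]; ring
    rw [this, hα, hβ]; ring

open Polynomial in
lemma exists_C_mul_of_associated {F : Type*} [Field F] {f g : F[X]} (h : Associated f g) :
    ∃ c : F, c ≠ 0 ∧ g = C c * f := by
  obtain ⟨u, rfl⟩ := h
  obtain ⟨c, hc, hu⟩ := Polynomial.isUnit_iff.mp u.isUnit
  exact ⟨c, hc.ne_zero, by rw [hu, mul_comm]⟩

open Polynomial in
lemma card_le_of_mem_span_pair {F : Type*} [Field F] [Fintype F] {A B : F[X] × F[X]} {N : ℕ}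
    (Q : ℕ → F[X] × F[X]) (hQ : ∀ i < N, Q i ∈ Submodule.span F {A, B})
    (hne : ∀ i j, i < j → j < N → cross (Q i) (Q j) ≠ 0) : N ≤ Fintype.card F + 1 := by
  classical
  simp only [Submodule.mem_span_pair] at hQ
  choose! c d hcd using hQ
  have hcross : ∀ i < N, ∀ j < N, cross (Q i) (Q j) = C (c i * d j - c j * d i) * cross A B := by
    intro i hi j hj
    rw [← hcd i hi, ← hcd j hj]
    simp only [cross, Prod.fst_add, Prod.snd_add, Prod.smul_fst, Prod.smul_snd, smul_eq_C_mul,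
      C_sub, C_mul]
    ring
  let f : Fin N → Option F := fun i => if c i = 0 then none else some (d i / c i)
  have hf : ∀ i j : Fin N, i < j → f i ≠ f j := by
    intro i j hij hfij
    refine hne i j hij j.2 ?_
    rw [hcross i i.2 j j.2]
    have : c i * d j - c j * d i = 0 := by
      simp only [f] at hfij
      split_ifs at hfij with h1 h2 h2
      · rw [h1, h2]; ring
      · rw [Option.some_inj, div_eq_div_iff h1 h2] at hfij
        linear_combination -hfij
    rw [this, C_0, zero_mul]
  have hinj : Function.Injective f := by
    intro i j hij
    by_contra hne
    rcases lt_or_gt_of_ne hne with h | h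
    · exact hf i j h hij
    · exact hf j i h hij.symm
  simpa using Fintype.card_le_of_injective f hinj

namespace IsContracting

open Polynomial

variable {F : Type*} [Field F] [Fintype F] {Q : ℕ → F[X] × F[X]}

lemma period_le_of_associated {n : ℕ} (hne : ∀ i j, i < j → j < i + n → cross (Q i) (Q j) ≠ 0)
    (h₁ : ∀ i, Associated (cross (Q 0) (Q 1)) (cross (Q i) (Q (i + 1))))
    (h₂ : ∀ i, Associated (cross (Q 0) (Q 1)) (cross (Q i) (Q (i + 2)))) :
    n ≤ Fintype.card F + 1 := by
  rcases Nat.lt_or_ge n 2 with hn | hn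
  · have := Fintype.card_pos (α := F); omega
  have hmem : ∀ i, Q i ∈ Submodule.span F {Q 0, Q 1} ∧ Q (i + 1) ∈ Submodule.span F {Q 0, Q 1} := by
    intro i
    induction i with
    | zero => exact ⟨Submodule.subset_span (by simp), Submodule.subset_span (by simp)⟩
    | succ i ih =>
      refine ⟨ih.2, ?_⟩
      obtain ⟨α, -, hα⟩ := exists_C_mul_of_associated ((h₁ i).symm.trans (h₁ (i + 1)))
      obtain ⟨β, -, hβ⟩ := exists_C_mul_of_associated ((h₁ i).symm.trans (h₂ i))
      have : Q (i + 2) ∈ Submodule.span F {Q i, Q (i + 1)} := by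
        refine mem_span_pair_of_cross (hne i (i + 1) (by omega) (by omega)) (α := -α) (β := β) ?_ hβ
        rw [cross_comm_neg, hα, C_neg, neg_mul]
      refine Submodule.span_le.mpr ?_ this
      rintro x (rfl | rfl)
      exacts [ih.1, ih.2]
  exact card_le_of_mem_span_pair Q (fun i _ => (hmem i).1) fun i j hij hj => hne i j hij (by omega)

lemma odd_period_le (h : IsContracting Q) {n : ℕ} (hn : Odd n) (h0 : cross (Q 0) (Q n) = 0)
    (hne : ∀ i j, i < j → j < i + n → cross (Q i) (Q j) ≠ 0) : n ≤ Fintype.card F + 1 :=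
  period_le_of_associated hne
    (h.associated_of_coprime hn.pos h0 (Nat.coprime_one_left n))
    (h.associated_of_coprime hn.pos h0 (Nat.coprime_two_left.mpr hn))

lemma two_pow_period_le (h : IsContracting Q) {n e : ℕ} (hn : n = 2 ^ e) (h0 : cross (Q 0) (Q n) = 0)
    (hne : ∀ i j, i < j → j < i + n → cross (Q i) (Q j) ≠ 0) :
    n ≤ Fintype.card F + 1 := by
  rcases Nat.lt_or_ge e 2 with he | he
  · have := Fintype.one_lt_card (α := F)
    interval_cases e <;> omega
  have hpos : 0 < n := hn ▸ by positivity
  have hfour : 4 ≤ n := hn ▸ by simpa using Nat.pow_le_pow_right (n := 2) (by norm_num) he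
  have hodd : ∀ k, Odd k → ∀ i, Associated (cross (Q 0) (Q 1)) (cross (Q i) (Q (i + k))) :=
    fun k hk => h.associated_of_coprime hpos h0 (hn ▸ (Nat.coprime_two_right.mpr hk).pow_right e)
  have hx : cross (Q 0) (Q 1) ≠ 0 := hne 0 1 (by omega) (by omega)
  have hdvd : ∀ i j, cross (Q 0) (Q 1) ∣ cross (Q i) (Q j) := fun i j =>
    h.dvd_cross_of_coprime (i := 0) (k := 1) hpos h0 (Nat.coprime_one_left n) i j
  refine period_le_of_associated hne (hodd 1 odd_one) fun i => ?_
  have hi : Associated (cross (Q 0) (Q (0 + 2))) (cross (Q i) (Q (i + 2))) :=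
    associated_of_dvd_dvd (h.dvd_cross_of_periodic hpos h0 0 2 i)
      (h.dvd_cross_of_periodic hpos h0 i 2 0)
  refine Associated.trans ?_ hi
  obtain ⟨s, hs⟩ := hdvd 0 2
  obtain ⟨t, ht⟩ := hdvd 1 3
  obtain ⟨a, -, ha⟩ := exists_C_mul_of_associated (hodd 1 odd_one 2)
  obtain ⟨b, -, hb⟩ := exists_C_mul_of_associated (hodd 3 ⟨1, rfl⟩ 0)
  obtain ⟨c, -, hc⟩ := exists_C_mul_of_associated (hodd 1 odd_one 1)
  have hst : s * t = C (a + b * c) := by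
    have := cross_plucker (Q 0) (Q 1) (Q 2) (Q 3)
    simp only [zero_add, Nat.reduceAdd] at ha hb hc
    rw [hs, ht, ha, hb, hc] at this
    apply mul_left_cancel₀ (mul_ne_zero hx hx)
    rw [C_add, C_mul]
    linear_combination -this
  have hs0 : s ≠ 0 := by rintro rfl; exact hne 0 2 (by omega) (by omega) (by simpa using hs)
  have ht0 : t ≠ 0 := by rintro rfl; exact hne 1 3 (by omega) (by omega) (by simpa using ht)
  have hunit : IsUnit (s * t) := by
    rw [hst]
    have hne0 : a + b * c ≠ 0 := fun h0 => by
      rw [h0, C_0] at hst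
      exact mul_ne_zero hs0 ht0 hst
    exact isUnit_C.mpr hne0.isUnit
  rw [zero_add, hs]
  exact (associated_mul_unit_right _ _ (isUnit_of_mul_isUnit_left hunit))

lemma tail_le (h : IsContracting Q) {L : ℕ} (hL : cross (Q L) (Q (L + 1)) = 0)
    (hne : ∀ i j, i < j → j ≤ L → cross (Q i) (Q j) ≠ 0) : L ≤ Fintype.card F + 1 := by
  rcases Nat.lt_or_ge L 2 with hL2 | hL2
  · have := Fintype.card_pos (α := F); omega
  have hconst : ∀ j, L ≤ j → cross (Q L) (Q j) = 0 := fun j hj => by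
    obtain ⟨s, rfl⟩ := Nat.exists_eq_add_of_le hj
    simpa using h.cross_mul_eq_zero hL s
  have hassoc : ∀ i j, i < j → j ≤ L → Associated (cross (Q i) (Q L)) (cross (Q i) (Q j)) := by
    intro i j hij hj
    obtain ⟨k, rfl⟩ := Nat.exists_eq_add_of_lt hij
    refine associated_of_dvd_dvd ?_ ?_
    · refine dvd_cross_trans (h.coprime L) dvd_rfl ?_
      have h1 := h.dvd_add i L (k + 1)
      rw [dvd_cross_comm]
      refine dvd_cross_trans (h.coprime _) h1 ?_
      rw [dvd_cross_comm, hconst _ (by omega)]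
      exact dvd_zero _
    · have h1 := h.dvd_cross_mul (i := i) (k := k + 1) dvd_rfl L
      refine dvd_cross_trans (h.coprime _) h1 ?_
      rw [dvd_cross_comm, hconst _ (by nlinarith)]
      exact dvd_zero _
  refine card_le_of_mem_span_pair (A := Q 1) (B := Q L) (fun i => Q (i + 1)) (fun i hi => ?_)
    fun i j hij hj => hne _ _ (by omega) (by omega)
  rcases Nat.eq_zero_or_pos i with rfl | hi0
  · exact Submodule.subset_span (by simp)
  have h1L := hne 1 L (by omega) le_rfl
  have h0L := hne 0 L (by omega) le_rfl
  obtain ⟨a, ha0, ha⟩ := exists_C_mul_of_associated (hassoc 0 1 (by omega) (by omega))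
  obtain ⟨b, -, hb⟩ := exists_C_mul_of_associated (hassoc 0 (i + 1) (by omega) (by omega))
  obtain ⟨c, -, hc⟩ := exists_C_mul_of_associated (hassoc 1 (i + 1) (by omega) (by omega))
  refine mem_span_pair_of_cross h1L (α := a⁻¹ * (b - c)) (β := c) ?_ hc
  have := cross_plucker (Q 0) (Q 1) (Q (i + 1)) (Q L)
  rw [ha, hb, hc] at this
  refine mul_left_cancel₀ (mul_ne_zero h0L (C_ne_zero.mpr ha0)) ?_
  have haa : C a * C a⁻¹ = 1 := by rw [← C_mul, mul_inv_cancel₀ ha0, C_1]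
  rw [C_mul, C_sub]
  linear_combination this - (cross (Q 0) (Q L)) * (C b - C c) * cross (Q 1) (Q L) * haa

/-- An eventually periodic contracting sequence takes few values up to proportionality. -/
theorem exists_cross_eq_zero (h : IsContracting Q)
    (hpre : ∃ m n, 0 < n ∧ cross (Q m) (Q (m + n)) = 0) :
    ∃ N ≤ (Fintype.card F + 1) ^ 2 * (Fintype.card F + 2),
      ∀ k, ∃ j < N, cross (Q j) (Q k) = 0 := by
  classical
  have hex : ∃ n, 0 < n ∧ ∃ m, cross (Q m) (Q (m + n)) = 0 := by
    obtain ⟨m, n, hn, hm⟩ := hpre; exact ⟨n, hn, m, hm⟩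
  obtain ⟨hn, m, hm⟩ := Nat.find_spec hex
  have hmin := fun k => Nat.find_min hex (m := k)
  set n := Nat.find hex with hn_def
  clear_value n
  have hne : ∀ i j, i < j → j < i + n → cross (Q i) (Q j) ≠ 0 := by
    intro i j hij hj hc
    obtain ⟨k, rfl⟩ := Nat.exists_eq_add_of_lt hij
    exact hmin (k + 1) (by omega) ⟨by omega, i, hc⟩
  have hcycle : n ≤ (Fintype.card F + 1) ^ 2 := by
    obtain ⟨e, w, hw, rfl⟩ := Nat.exists_eq_two_pow_mul_odd hn.ne'
    have hpos : 0 < 2 ^ e := by positivity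
    have h1 : w ≤ Fintype.card F + 1 := by
      refine (h.subsequence m (2 ^ e)).odd_period_le hw (by simpa using hm) fun i j hij hj => ?_
      refine hne _ _ (by gcongr) ?_
      have : 2 ^ e * j < 2 ^ e * (i + w) := by gcongr
      linarith
    have h2 : 2 ^ e ≤ Fintype.card F + 1 := by
      refine (h.subsequence m w).two_pow_period_le rfl (by simpa [mul_comm] using hm)
        fun i j hij hj => ?_
      have := hw.pos
      refine hne _ _ (by gcongr) ?_
      have : w * j < w * (i + 2 ^ e) := by gcongr
      linarith
    calc 2 ^ e * w ≤ _ := Nat.mul_le_mul h2 h1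
      _ = _ := by ring
  refine ⟨n * (Fintype.card F + 2), Nat.mul_le_mul_right _ hcycle, fun k => ?_⟩
  set c := k % n with hc
  have hcn : c < n := Nat.mod_lt _ hn
  have hS := h.subsequence c n
  set S : ℕ → F[X] × F[X] := fun i => Q (c + n * i) with hS_def
  have hfix : ∃ L, cross (S L) (S (L + 1)) = 0 := by
    refine ⟨m, ?_⟩
    have hle : m ≤ n * m := Nat.le_mul_of_pos_left m hn
    have := h.cross_add_eq_zero hm (c + n * m - m)
    rw [show m + (c + n * m - m) = c + n * m by omega,
      show m + n + (c + n * m - m) = c + n * (m + 1) by rw [mul_add]; omega] at this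
    exact this
  have hLspec := Nat.find_spec hfix
  have hLmin := fun i => Nat.find_min hfix (m := i)
  set L := Nat.find hfix with hL_def
  clear_value L
  have hconst : ∀ j, L ≤ j → cross (S L) (S j) = 0 := fun j hj => by
    obtain ⟨s, rfl⟩ := Nat.exists_eq_add_of_le hj
    simpa using hS.cross_mul_eq_zero hLspec s
  have hL : L ≤ Fintype.card F + 1 := by
    refine hS.tail_le hLspec fun i j hij hj h0 => ?_
    refine hLmin (L - 1) (by omega) ?_
    have h1 := hS.cross_add_eq_zero h0 (L - 1 - i)
    have h2 := hconst (j + (L - 1 - i)) (by omega)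
    rw [show i + (L - 1 - i) = L - 1 by omega] at h1
    rw [show L - 1 + 1 = L by omega]
    rw [cross_comm_neg, neg_eq_zero] at h2
    exact hS.cross_trans h1 h2
  have hk : S (k / n) = Q k := by simp only [hS_def, hc, Nat.mod_add_div]
  rw [← hk]
  have hlt : ∀ i ≤ Fintype.card F + 1, c + n * i < n * (Fintype.card F + 2) := fun i hi => by
    nlinarith [Nat.mul_le_mul_left n hi]
  rcases le_total (k / n) L with hkL | hkL
  · exact ⟨_, hlt _ (hkL.trans hL), cross_same _⟩
  · exact ⟨_, hlt _ hL, hconst _ hkL⟩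

end IsContracting

lemma map_evalPair {R S : Type} [CommRing R] [CommRing S] (f : R →+* S) (d : ℕ)
    (a b : Fin (d + 1) → R) (P : R × R) :
    evalPair d (fun i => f (a i)) (fun i => f (b i)) (P.map f f) = (evalPair d a b P).map f f := by
  simp [evalPair]

lemma evalPair_smul {R : Type} [CommRing R] (d : ℕ) (a b : Fin (d + 1) → R) (c : R) (P : R × R) :
    evalPair d a b (c • P) = c ^ d • evalPair d a b P := by
  have key : ∀ a : Fin (d + 1) → R,
      ∑ i : Fin (d + 1), a i * (c * P.1) ^ (i : ℕ) * (c * P.2) ^ (d - (i : ℕ)) =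
        c ^ d * ∑ i : Fin (d + 1), a i * P.1 ^ (i : ℕ) * P.2 ^ (d - (i : ℕ)) := by
    intro a
    rw [Finset.mul_sum]
    refine Finset.sum_congr rfl fun i _ => ?_
    have : c ^ d = c ^ (i : ℕ) * c ^ (d - (i : ℕ)) := by rw [← pow_add]; congr 1; omega
    rw [this]; ring
  ext1 <;> simp [evalPair, key]

lemma evalPair_mul_coeff {R : Type} [CommRing R] (d : ℕ) (a b : Fin (d + 1) → R) (c : R)
    (P : R × R) :
    evalPair d (fun i => c * a i) (fun i => c * b i) P = c • evalPair d a b P := by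
  ext1 <;> simp [evalPair, Finset.mul_sum, mul_assoc]

lemma cross_smul_smul {R : Type*} [CommRing R] (c c' : R) (P Q : R × R) :
    cross (c • P) (c' • Q) = c * c' * cross P Q := by
  simp only [cross, Prod.smul_fst, Prod.smul_snd, smul_eq_mul]; ring

lemma cross_smul_self {R : Type*} [CommRing R] (c : R) (P : R × R) : cross P (c • P) = 0 := by
  simp only [cross, Prod.smul_fst, Prod.smul_snd, smul_eq_mul]; ring

lemma cross_map {R S : Type*} [CommRing R] [CommRing S] (f : R →+* S) (P Q : R × R) :
    cross (P.map f f) (Q.map f f) = f (cross P Q) := by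
  simp [cross]

lemma exists_eq_smul_of_cross_eq_zero {R : Type*} [CommRing R] {P Q : R × R}
    (hP : IsCoprime P.1 P.2) (h : cross P Q = 0) : ∃ c : R, Q = c • P := by
  obtain ⟨s, t, hst⟩ := hP
  simp only [cross] at h
  refine ⟨s * Q.1 + t * Q.2, ?_⟩
  ext1 <;> simp only [Prod.smul_fst, Prod.smul_snd, smul_eq_mul]
  · linear_combination (-Q.1) * hst - t * h
  · linear_combination (-Q.2) * hst + s * h

lemma map_smul_prod {R S : Type*} [CommRing R] [CommRing S] (f : R →+* S) (c : R) (P : R × R) :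
    (c • P).map f f = f c • P.map f f := by
  ext1 <;> simp

lemma cross_dvd_cross_evalPair {R : Type} [CommRing R] (d : ℕ) (a b : Fin (d + 1) → R)
    {P Q : R × R} (hP : IsCoprime P.1 P.2) :
    cross P Q ∣ cross (evalPair d a b P) (evalPair d a b Q) := by
  rw [← Ideal.mem_span_singleton, ← Ideal.Quotient.eq_zero_iff_mem]
  set f := Ideal.Quotient.mk (Ideal.span {cross P Q})
  have h0 : cross (P.map f f) (Q.map f f) = 0 := by
    rw [cross_map, Ideal.Quotient.eq_zero_iff_mem]
    exact Ideal.mem_span_singleton_self _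
  obtain ⟨c, hc⟩ := exists_eq_smul_of_cross_eq_zero (P := P.map f f) (hP.map f) h0
  rw [← cross_map, ← map_evalPair, ← map_evalPair, hc, evalPair_smul, cross_smul_self]

lemma sylvester_mulVec {R : Type} [CommRing R] (d : ℕ) (a b : Fin (d + 1) → R) (P : R × R)
    (i : Fin (d + d)) :
    (sylvester d a b).mulVec (fun j => P.1 ^ (j : ℕ) * P.2 ^ (d + d - 1 - (j : ℕ))) i =
      if (i : ℕ) < d then P.1 ^ (i : ℕ) * P.2 ^ (d - 1 - (i : ℕ)) * (evalPair d a b P).1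
      else P.1 ^ ((i : ℕ) - d) * P.2 ^ (d + d - 1 - (i : ℕ)) * (evalPair d a b P).2 := by
  have key : ∀ (c : Fin (d + 1) → R) (s t : ℕ), s < d → (ht : t = s + d) →
      ∑ j : Fin (d + d), (if hj : s ≤ (j : ℕ) ∧ (j : ℕ) ≤ t then
        c ⟨(j : ℕ) - s, by omega⟩ else 0) * (P.1 ^ (j : ℕ) * P.2 ^ (d + d - 1 - (j : ℕ))) =
      P.1 ^ s * P.2 ^ (d - 1 - s) *
        ∑ i : Fin (d + 1), c i * P.1 ^ (i : ℕ) * P.2 ^ (d - (i : ℕ)) := by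
    intro c s t hs ht
    rw [Finset.mul_sum]
    symm
    refine Finset.sum_of_injOn (fun k : Fin (d + 1) => (⟨k + s, by omega⟩ : Fin (d + d)))
      ?_ ?_ ?_ ?_
    · intro x _ y _ hxy
      simp only [Fin.mk.injEq, Nat.add_right_cancel_iff] at hxy
      exact Fin.ext hxy
    · exact fun _ _ => Finset.mem_univ _
    · intro j _ hj
      rw [dif_neg, zero_mul]
      intro hjs
      exact hj ⟨⟨j - s, by omega⟩, Finset.mem_univ _, Fin.ext (by simp; omega)⟩
    · intro k _
      have hk := k.2
      rw [dif_pos ⟨by simp, by simp; omega⟩]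
      simp only [Nat.add_sub_cancel, Fin.eta]
      rw [show d + d - 1 - ((k : ℕ) + s) = (d - 1 - s) + (d - k) by omega, pow_add, pow_add]
      ring
  have hi := i.2
  simp only [Matrix.mulVec, dotProduct, sylvester]
  split_ifs with h
  · exact key a i (i + d) h rfl
  · have := key b (i - d) i (by omega) (by omega)
    rw [show d - 1 - ((i : ℕ) - d) = d + d - 1 - i by omega] at this
    exact this

lemma isCoprime_evalPair {R : Type} [CommRing R] {d : ℕ} (hd : d ≠ 0) {a b : Fin (d + 1) → R}
    (hres : IsUnit (resultant d a b)) {P : R × R} (hP : IsCoprime P.1 P.2) :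
    IsCoprime (evalPair d a b P).1 (evalPair d a b P).2 := by
  set I := Ideal.span {(evalPair d a b P).1, (evalPair d a b P).2} with hI
  have h1 : (evalPair d a b P).1 ∈ I := Ideal.subset_span (by simp)
  have h2 : (evalPair d a b P).2 ∈ I := Ideal.subset_span (by simp)
  have hmem : ∀ j : Fin (d + d), P.1 ^ (j : ℕ) * P.2 ^ (d + d - 1 - (j : ℕ)) ∈ I := by
    intro j
    set w : Fin (d + d) → R := fun j => P.1 ^ (j : ℕ) * P.2 ^ (d + d - 1 - (j : ℕ)) with hw
    have : w = (sylvester d a b)⁻¹.mulVec ((sylvester d a b).mulVec w) := by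
      rw [Matrix.mulVec_mulVec, Matrix.nonsing_inv_mul _ hres, Matrix.one_mulVec]
    change w j ∈ I
    rw [this]
    change ∑ i, (sylvester d a b)⁻¹ j i * (sylvester d a b).mulVec w i ∈ I
    refine Ideal.sum_mem I fun i _ => Ideal.mul_mem_left _ _ ?_
    rw [hw, sylvester_mulVec]
    split_ifs
    · exact Ideal.mul_mem_left _ _ h1
    · exact Ideal.mul_mem_left _ _ h2
  have hx : P.1 ^ (d + d - 1) ∈ I := by simpa using hmem ⟨d + d - 1, by omega⟩
  have hy : P.2 ^ (d + d - 1) ∈ I := by simpa using hmem ⟨0, by omega⟩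
  obtain ⟨s, t, hst⟩ : IsCoprime (P.1 ^ (d + d - 1)) (P.2 ^ (d + d - 1)) := hP.pow
  refine Ideal.mem_span_pair.mp ?_
  rw [← hI, ← hst]
  exact I.add_mem (I.mul_mem_left _ hx) (I.mul_mem_left _ hy)

lemma isContracting_iterate_evalPair {R : Type} [CommRing R] {d : ℕ} (hd : d ≠ 0)
    {a b : Fin (d + 1) → R} (hres : IsUnit (resultant d a b)) {P : R × R}
    (hP : IsCoprime P.1 P.2) : IsContracting fun k => (evalPair d a b)^[k] P := by
  have hcop : ∀ k, IsCoprime ((evalPair d a b)^[k] P).1 ((evalPair d a b)^[k] P).2 := by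
    intro k
    induction k with
    | zero => exact hP
    | succ k ih =>
      rw [Function.iterate_succ_apply']
      exact isCoprime_evalPair hd hres ih
  refine ⟨hcop, fun i j => ?_⟩
  simp only [Function.iterate_succ_apply']
  exact cross_dvd_cross_evalPair d a b (hcop i)

lemma resultant_mul {R : Type} [CommRing R] (d : ℕ) (a b : Fin (d + 1) → R) (c : R) :
    resultant d (fun i => c * a i) (fun i => c * b i) = c ^ (d + d) * resultant d a b := by
  have : sylvester d (fun i => c * a i) (fun i => c * b i) = c • sylvester d a b := by
    ext i j
    simp only [sylvester, Matrix.smul_apply, smul_eq_mul]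
    split_ifs <;> simp
  rw [resultant, this, Matrix.det_smul, Fintype.card_fin, resultant]

lemma map_resultant {R S : Type} [CommRing R] [CommRing S] (f : R →+* S) (d : ℕ)
    (a b : Fin (d + 1) → R) :
    resultant d (fun i => f (a i)) (fun i => f (b i)) = f (resultant d a b) := by
  rw [resultant, resultant, RingHom.map_det]
  congr 1
  ext i j
  simp only [sylvester, RingHom.mapMatrix_apply, Matrix.map_apply]
  split_ifs <;> simp

/-- Over a principal ideal domain a nonzero family in the fraction field can be rescaled to an
integral family generating the unit ideal. -/
lemma exists_primitive_multiple {R K ι : Type*} [CommRing R] [IsDomain R] [IsPrincipalIdealRing R]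
    [Field K] [Algebra R K] [IsFractionRing R K] [Finite ι] (f : ι → K) (hf : f ≠ 0) :
    ∃ c : K, c ≠ 0 ∧ ∃ g : ι → R, (∀ i, algebraMap R K (g i) = c * f i) ∧
      Ideal.span (Set.range g) = ⊤ := by
  obtain ⟨⟨m, hm⟩, hint⟩ := IsLocalization.exist_integer_multiples_of_finite (nonZeroDivisors R) f
  choose g hg using hint
  have hm0 : algebraMap R K m ≠ 0 :=
    IsFractionRing.to_map_ne_zero_of_mem_nonZeroDivisors hm
  have hg' : ∀ i, algebraMap R K (g i) = algebraMap R K m * f i := fun i => by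
    rw [hg i, Algebra.smul_def]
  set γ := Submodule.IsPrincipal.generator (Ideal.span (Set.range g)) with hγ
  have hspan : Ideal.span {γ} = Ideal.span (Set.range g) := Ideal.span_singleton_generator _
  have hdvd : ∀ i, γ ∣ g i := fun i => by
    rw [← Ideal.mem_span_singleton, hspan]; exact Ideal.subset_span ⟨i, rfl⟩
  choose h hh using hdvd
  have hγ0 : γ ≠ 0 := by
    intro h0
    refine hf (funext fun i => ?_)
    have : algebraMap R K m * f i = 0 := by rw [← hg', hh, h0, zero_mul, map_zero]
    exact (mul_eq_zero.mp this).resolve_left hm0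
  have hγK : algebraMap R K γ ≠ 0 := (map_ne_zero_iff _ (IsFractionRing.injective R K)).mpr hγ0
  refine ⟨algebraMap R K m / algebraMap R K γ, div_ne_zero hm0 hγK, h, fun i => ?_, ?_⟩
  · have := hg' i
    rw [hh, map_mul] at this
    rw [div_mul_eq_mul_div, ← this, mul_div_cancel_left₀ _ hγK]
  · have hγmem : γ ∈ Ideal.span {γ} * Ideal.span (Set.range h) := by
      have : Ideal.span {γ} * Ideal.span (Set.range h) = Ideal.span (Set.range g) := by
        rw [Ideal.span_mul_span', Set.singleton_mul, ← Set.range_comp]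
        congr 2
        ext i
        simp [hh i]
      rw [this, ← hspan]
      exact Ideal.mem_span_singleton_self _
    obtain ⟨z, hz, hzγ⟩ := Ideal.mem_span_singleton_mul.mp hγmem
    rw [Ideal.eq_top_iff_one]
    rwa [show z = 1 from mul_left_cancel₀ hγ0 (by rw [hzγ, mul_one])] at hz

section

open UniqueFactorizationMonoid Polynomial

lemma polyVal_div {p : ℕ} [Fact p.Prime] (π : (ZMod p)[X]) {f g : (ZMod p)[X]} (hf : f ≠ 0)
    (hg : g ≠ 0) :
    polyVal p π (algebraMap _ (RatFunc (ZMod p)) f / algebraMap _ (RatFunc (ZMod p)) g) =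
      (((normalizedFactors f).count π - (normalizedFactors g).count π : ℤ) : WithTop ℤ) := by
  have hf' : algebraMap _ (RatFunc (ZMod p)) f ≠ 0 := RatFunc.algebraMap_ne_zero hf
  have hg' : algebraMap _ (RatFunc (ZMod p)) g ≠ 0 := RatFunc.algebraMap_ne_zero hg
  set x := algebraMap _ (RatFunc (ZMod p)) f / algebraMap _ (RatFunc (ZMod p)) g with hx
  have hx0 : x ≠ 0 := div_ne_zero hf' hg'
  have hn : x.num ≠ 0 := RatFunc.num_ne_zero hx0
  have hd : x.denom ≠ 0 := RatFunc.denom_ne_zero x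
  have heq : x.num * g = f * x.denom := (RatFunc.num_mul_eq_mul_denom_iff hg).mpr hx
  have hcount := congrArg (fun y => (normalizedFactors y).count π) heq
  simp only [normalizedFactors_mul hn hg, normalizedFactors_mul hf hd, Multiset.count_add]
    at hcount
  rw [polyVal, if_neg hx0, WithTop.coe_inj]
  omega

lemma polyVal_mul {p : ℕ} [Fact p.Prime] (π : (ZMod p)[X]) (x y : RatFunc (ZMod p)) :
    polyVal p π (x * y) = polyVal p π x + polyVal p π y := by
  by_cases hx : x = 0
  · simp [polyVal, hx]
  by_cases hy : y = 0
  · simp [polyVal, hy]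
  have hxn := RatFunc.num_ne_zero hx
  have hyn := RatFunc.num_ne_zero hy
  have hxd := RatFunc.denom_ne_zero x
  have hyd := RatFunc.denom_ne_zero y
  have h : x * y = algebraMap _ (RatFunc (ZMod p)) (x.num * y.num) /
      algebraMap _ (RatFunc (ZMod p)) (x.denom * y.denom) := by
    rw [map_mul, map_mul, ← div_mul_div_comm, RatFunc.num_div_denom, RatFunc.num_div_denom]
  rw [h, polyVal_div π (mul_ne_zero hxn hyn) (mul_ne_zero hxd hyd),
    normalizedFactors_mul hxn hyn, normalizedFactors_mul hxd hyd, polyVal, polyVal, if_neg hx,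
    if_neg hy, ← WithTop.coe_add, WithTop.coe_inj, Multiset.count_add, Multiset.count_add]
  push_cast
  ring

lemma polyVal_algebraMap {p : ℕ} [Fact p.Prime] (π : (ZMod p)[X]) {f : (ZMod p)[X]}
    (hf : f ≠ 0) : polyVal p π (algebraMap _ _ f) = ((normalizedFactors f).count π : ℤ) := by
  have := polyVal_div π hf one_ne_zero
  simpa using this

lemma polyVal_algebraMap_nonneg {p : ℕ} [Fact p.Prime] (π f : (ZMod p)[X]) :
    0 ≤ polyVal p π (algebraMap _ _ f) := by
  by_cases hf : f = 0
  · simp [polyVal, hf]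
  · rw [polyVal_algebraMap π hf]
    exact_mod_cast Nat.zero_le _

lemma polyVal_algebraMap_eq_zero_iff {p : ℕ} [Fact p.Prime] {π : (ZMod p)[X]} (hm : π.Monic)
    (hirr : Irreducible π) (f : (ZMod p)[X]) : polyVal p π (algebraMap _ _ f) = 0 ↔ ¬ π ∣ f := by
  by_cases hf : f = 0
  · simp [polyVal, hf]
  · rw [polyVal_algebraMap π hf, ← WithTop.coe_zero, WithTop.coe_inj, Nat.cast_eq_zero,
      Multiset.count_eq_zero, mem_normalizedFactors_iff' hf]
    simp [hirr, hm.normalize_eq_self]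

/-- A pair of forms with good reduction at every finite place of `F_p(t)` is proportional to a
pair with polynomial coefficients whose resultant is a unit. -/
lemma exists_integral_model {p : ℕ} [Fact p.Prime] {d : ℕ} {a b : Fin (d + 1) → RatFunc (ZMod p)}
    (hgood : ∀ π : (ZMod p)[X], π.Monic → Irreducible π → GoodReduction (polyVal p π) d a b) :
    ∃ c : RatFunc (ZMod p), c ≠ 0 ∧ ∃ a' b' : Fin (d + 1) → (ZMod p)[X],
      (∀ i, algebraMap _ _ (a' i) = c * a i) ∧ (∀ i, algebraMap _ _ (b' i) = c * b i) ∧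
      IsUnit (resultant d a' b') := by
  have hne : Sum.elim a b ≠ 0 := by
    intro h0
    obtain ⟨u, -, -, h | h, -⟩ := hgood X monic_X irreducible_X <;> obtain ⟨i, hi⟩ := h
    · simp [show a i = 0 from congrFun h0 (Sum.inl i), polyVal] at hi
    · simp [show b i = 0 from congrFun h0 (Sum.inr i), polyVal] at hi
  obtain ⟨c, hc, g, hg, hspan⟩ := exists_primitive_multiple (R := (ZMod p)[X]) _ hne
  refine ⟨c, hc, fun i => g (Sum.inl i), fun i => g (Sum.inr i), fun i => hg _, fun i => hg _, ?_⟩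
  set r := resultant d (fun i => g (Sum.inl i)) (fun i => g (Sum.inr i)) with hr
  have hndvd : ∀ π : (ZMod p)[X], π.Monic → Irreducible π → ¬ π ∣ r := by
    intro π hm hirr
    obtain ⟨u, hu, hint, hex, hres⟩ := hgood π hm hirr
    set w := u / c with hw
    have hw0 : w ≠ 0 := div_ne_zero hu hc
    have hwg : ∀ i, w * algebraMap _ _ (g i) = u * Sum.elim a b i := fun i => by
      rw [hg, hw]; field_simp
    obtain ⟨i, hi⟩ : ∃ i, ¬ π ∣ g i := by
      by_contra! hall
      refine hirr.not_isUnit (Ideal.span_singleton_eq_top.mp (top_le_iff.mp ?_))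
      rw [← hspan, Ideal.span_le]
      rintro _ ⟨i, rfl⟩
      exact Ideal.mem_span_singleton.mpr (hall i)
    have hint' : ∀ i, 0 ≤ polyVal p π (u * Sum.elim a b i) := by
      rintro (i | i)
      exacts [(hint i).1, (hint i).2]
    have hex' : ∃ i, polyVal p π (u * Sum.elim a b i) = 0 := by
      rcases hex with ⟨i, hi⟩ | ⟨i, hi⟩
      exacts [⟨Sum.inl i, hi⟩, ⟨Sum.inr i, hi⟩]
    have hwv : polyVal p π w = 0 := by
      refine le_antisymm ?_ ?_
      · obtain ⟨j, hj⟩ := hex'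
        rw [← hwg, polyVal_mul] at hj
        rw [← hj]
        exact le_add_of_nonneg_right (polyVal_algebraMap_nonneg _ _)
      · have := hint' i
        rwa [← hwg, polyVal_mul, (polyVal_algebraMap_eq_zero_iff hm hirr _).mpr hi, add_zero]
          at this
    have hpow : ∀ k, polyVal p π (w ^ k) = 0 := fun k => by
      induction k with
      | zero => simpa [hirr.not_dvd_one] using polyVal_algebraMap_eq_zero_iff hm hirr 1
      | succ k ih => rw [pow_succ, polyVal_mul, ih, hwv, add_zero]
    have hleft : (fun i => u * a i) = fun i => w * algebraMap _ _ (g (Sum.inl i)) :=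
      funext fun i => (hwg (Sum.inl i)).symm
    have hright : (fun i => u * b i) = fun i => w * algebraMap _ _ (g (Sum.inr i)) :=
      funext fun i => (hwg (Sum.inr i)).symm
    rw [hleft, hright, resultant_mul, map_resultant, polyVal_mul, hpow, zero_add] at hres
    exact (polyVal_algebraMap_eq_zero_iff hm hirr _).mp hres
  by_contra hunit
  have hr0 : r ≠ 0 := fun h0 => hndvd X monic_X irreducible_X (h0 ▸ dvd_zero _)
  obtain ⟨π, hirr, hπ⟩ := WfDvdMonoid.exists_irreducible_factor hunit hr0
  exact hndvd (normalize π) (monic_normalize hirr.ne_zero)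
    ((normalize_associated π).irreducible_iff.mpr hirr) (normalize_dvd_iff.mpr hπ)

end

lemma exists_coprime_multiple {R K : Type*} [CommRing R] [IsDomain R] [IsPrincipalIdealRing R]
    [Field K] [Algebra R K] [IsFractionRing R K] {P : K × K} (hP : P ≠ (0, 0)) :
    ∃ c : K, c ≠ 0 ∧ ∃ Q : R × R, IsCoprime Q.1 Q.2 ∧
      Q.map (algebraMap R K) (algebraMap R K) = c • P := by
  have hne : ![P.1, P.2] ≠ 0 := fun h0 =>
    hP (Prod.ext (congrFun h0 0) (congrFun h0 1))
  obtain ⟨c, hc, g, hg, hspan⟩ := exists_primitive_multiple (R := R) _ hne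
  refine ⟨c, hc, (g 0, g 1), ?_, Prod.ext (hg 0) (hg 1)⟩
  have h1 : (1 : R) ∈ Ideal.span {g 0, g 1} := by
    have : Set.range g = {g 0, g 1} := by
      ext x; simp [Fin.exists_fin_two, eq_comm]
    rw [← this, hspan]; exact Submodule.mem_top
  exact Ideal.mem_span_pair.mp h1

lemma exists_iterate_evalPair_eq_smul {R K : Type} [CommRing R] [Field K] [Algebra R K]
    {d : ℕ} {a b : Fin (d + 1) → K} {a' b' : Fin (d + 1) → R} {c : K} (hc : c ≠ 0)
    (ha : ∀ i, algebraMap R K (a' i) = c * a i) (hb : ∀ i, algebraMap R K (b' i) = c * b i)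
    {P : K × K} {P' : R × R} {s : K} (hs : s ≠ 0)
    (hP : P'.map (algebraMap R K) (algebraMap R K) = s • P) (k : ℕ) :
    ∃ s : K, s ≠ 0 ∧ ((evalPair d a' b')^[k] P').map (algebraMap R K) (algebraMap R K) =
      s • (evalPair d a b)^[k] P := by
  induction k with
  | zero => exact ⟨s, hs, hP⟩
  | succ k ih =>
    obtain ⟨s, hs, h⟩ := ih
    refine ⟨s ^ d * c, mul_ne_zero (pow_ne_zero _ hs) hc, ?_⟩
    rw [Function.iterate_succ_apply', Function.iterate_succ_apply', ← map_evalPair, h,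
      evalPair_smul, funext ha, funext hb, evalPair_mul_coeff, smul_smul]

/-- Let `p ≥ 5` be a prime and let `φ = [F:G]` be an endomorphism of `ℙ¹` of degree
`d ≥ 2` defined over `F_p(t)` with good reduction at every finite place.  If
`P ∈ ℙ¹(F_p(t))` is a preperiodic point for `φ`, then its forward orbit
`O_φ(P) = {φ^n(P) : n ∈ ℕ}` (as a set of points of `ℙ¹`, i.e. of projective
classes) has cardinality at most `(p+1)(p²−1)p`. -/
theorem orbit_card_bound_char_ge_five (p : ℕ) [Fact p.Prime] (hp : 5 ≤ p)
    (d : ℕ) (hd : 2 ≤ d)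
    (a b : Fin (d+1) → RatFunc (ZMod p))
    (hgood : ∀ π : Polynomial (ZMod p), π.Monic → Irreducible π →
      GoodReduction (polyVal p π) d a b)
    (P : RatFunc (ZMod p) × RatFunc (ZMod p)) (hP : P ≠ (0, 0))
    (hpre : ∃ m n : ℕ, 0 < n ∧ ∃ c : RatFunc (ZMod p), c ≠ 0 ∧
      (evalPair d a b)^[m + n] P = c • (evalPair d a b)^[m] P) :
    ∃ T : Finset (RatFunc (ZMod p) × RatFunc (ZMod p)),
      T.card ≤ (p + 1) * ((p ^ 2 - 1) * p) ∧
      ∀ k : ℕ, ∃ Q ∈ T, ∃ c : RatFunc (ZMod p), c ≠ 0 ∧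
        (evalPair d a b)^[k] P = c • Q := by
  obtain ⟨c, hc, a', b', ha, hb, hres⟩ := exists_integral_model hgood
  obtain ⟨s, hs, P', hcop, hP'⟩ := exists_coprime_multiple (R := Polynomial (ZMod p)) hP
  have hcontr := isContracting_iterate_evalPair (by omega) hres hcop
  choose σ hσ hσP using exists_iterate_evalPair_eq_smul hc ha hb hs hP'
  set Q' : ℕ → Polynomial (ZMod p) × Polynomial (ZMod p) := fun k => (evalPair d a' b')^[k] P' with hQ'
  have hinj := RatFunc.algebraMap_injective (ZMod p)
  have hcross : ∀ i j, algebraMap _ (RatFunc (ZMod p)) (cross (Q' i) (Q' j)) =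
      σ i * σ j * cross ((evalPair d a b)^[i] P) ((evalPair d a b)^[j] P) := fun i j => by
    rw [← cross_map, hσP, hσP, cross_smul_smul]
  obtain ⟨N, hN, hcov⟩ := hcontr.exists_cross_eq_zero <| by
    obtain ⟨m, n, hn, e, -, h⟩ := hpre
    refine ⟨m, n, hn, hinj ?_⟩
    rw [hcross, h, cross_smul_self, mul_zero, map_zero]
  refine ⟨(Finset.range N).image fun j => (evalPair d a b)^[j] P, ?_, fun k => ?_⟩
  · refine Finset.card_image_le.trans ?_
    rw [Finset.card_range]
    refine hN.trans ?_
    rw [ZMod.card]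
    obtain ⟨q, rfl⟩ := Nat.exists_eq_add_of_le' (show 1 ≤ p by omega)
    rw [show (q + 1) ^ 2 - 1 = q * (q + 2) by
      rw [show (q + 1) ^ 2 = q * (q + 2) + 1 by ring, Nat.add_sub_cancel]]
    have : q + 3 ≤ q * (q + 1) := by nlinarith
    calc (q + 1 + 1) ^ 2 * (q + 1 + 2) = (q + 2) * (q + 2) * (q + 3) := by ring
      _ ≤ (q + 2) * (q + 2) * (q * (q + 1)) := Nat.mul_le_mul_left _ this
      _ = _ := by ring
  · obtain ⟨j, hj, h0⟩ := hcov k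
    refine ⟨_, Finset.mem_image_of_mem _ (Finset.mem_range.mpr hj), ?_⟩
    obtain ⟨e, he⟩ := exists_eq_smul_of_cross_eq_zero (hcontr.coprime j) h0
    have hcopk := hcontr.coprime k
    have he0 : e ≠ 0 := by
      rintro rfl
      rw [he, zero_smul] at hcopk
      exact not_isCoprime_zero_zero hcopk
    refine ⟨(σ k)⁻¹ * algebraMap _ _ e * σ j, mul_ne_zero (mul_ne_zero (inv_ne_zero (hσ k))
      (RatFunc.algebraMap_ne_zero he0)) (hσ j), ?_⟩
    have hk := hσP k
    rw [show (evalPair d a' b')^[k] P' = e • (evalPair d a' b')^[j] P' from he] at hk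
    rw [map_smul_prod, hσP] at hk
    rw [mul_assoc, mul_smul, mul_smul, hk, inv_smul_smul₀ (hσ k)]
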